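/- Let q be a prime power. Then there exist ν > 0, an integer d ≥ 1 and a balanced function ψ : F_q^d → [−1/4, 1/4] such that Λ_L(ψ) < −ν for every (2×4)-system L over F_q with s(L) = 3. -/

import Mathlib

open Finset

section Defs

variable {F : Type} [Field F] [Fintype F] [DecidableEq F]

/-- The set of solutions to `L x = 0` with all coordinates in `A ⊆ F^n`. -/
def solSet {m k n : ℕ} (L : Matrix (Fin m) (Fin k) F) (A : Set (Fin n → F)) :
    Set (Fin k → Fin n → F) :=
  {x | (∀ j, x j ∈ A) ∧ ∀ i, ∑ j, L i j • x j = 0}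

/-- The finset of all solutions to `L x = 0` over `F^n`. -/
def solutions {m k : ℕ} (L : Matrix (Fin m) (Fin k) F) (n : ℕ) :
    Finset (Fin k → Fin n → F) :=
  Finset.univ.filter fun x => ∀ i, ∑ j, L i j • x j = 0

/-- `Λ_L(f)`, the density of solutions to `L = 0` with respect to `f`. -/
noncomputable def lambdaSol {m k n : ℕ} (L : Matrix (Fin m) (Fin k) F) (f : (Fin n → F) → ℝ) : ℝ :=
  (∑ x ∈ solutions L n, ∏ j, f (x j)) / (solutions L n).card

/-- `Δ_L(f) = Λ_L(1/2 + f) + Λ_L(1/2 − f)`. -/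
noncomputable def deltaSol {m k n : ℕ} (L : Matrix (Fin m) (Fin k) F) (f : (Fin n → F) → ℝ) : ℝ :=
  lambdaSol L (fun y => 1 / 2 + f y) + lambdaSol L (fun y => 1 / 2 - f y)

/-- `L` is common: for every `n ≥ 1` and every `f : F^n → [-1/2,1/2]`,
`Δ_L(f) ≥ 2^(1-k)`. -/
def IsCommon {m k : ℕ} (L : Matrix (Fin m) (Fin k) F) : Prop :=
  ∀ n : ℕ, 1 ≤ n → ∀ f : (Fin n → F) → ℝ,
    (∀ y, f y ∈ Set.Icc (-(1 / 2) : ℝ) (1 / 2)) →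
    (2 : ℝ) ^ (1 - (k : ℤ)) ≤ deltaSol L f

/-- The rows of the coefficient matrix `L` are linearly independent. -/
def RowsIndep {m k : ℕ} (L : Matrix (Fin m) (Fin k) F) : Prop :=
  LinearIndependent F fun i => fun j => L i j

/-- `L` induces the `ℓ`-variable system `L'` on the set `B` (with `B` listed in
increasing order). -/
def InducesOn {m k m' ℓ : ℕ} (L : Matrix (Fin m) (Fin k) F)
    (L' : Matrix (Fin m') (Fin ℓ) F) (B : Finset (Fin k)) (hB : B.card = ℓ) : Prop :=
  ∀ x : Fin k → F, (∀ i, ∑ j, L i j * x j = 0) →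
    ∀ r, ∑ t, L' r t * x (B.orderIsoOfFin hB t).1 = 0

/-- `L` is irredundant: it does not induce the equation `x i − x j = 0` for any `i ≠ j`. -/
def IsIrredundant {m k : ℕ} (L : Matrix (Fin m) (Fin k) F) : Prop :=
  ¬ ∃ i j : Fin k, i ≠ j ∧
    ∀ x : Fin k → F, (∀ r, ∑ t, L r t * x t = 0) → x i = x j

/-- `c` is a (single) linear equation induced by `L`. -/
def InducedEq {m k : ℕ} (L : Matrix (Fin m) (Fin k) F) (c : Fin k → F) : Prop :=
  ∀ x : Fin k → F, (∀ i, ∑ j, L i j * x j = 0) → ∑ j, c j * x j = 0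

/-- Length of an equation: the number of variables with nonzero coefficient. -/
def eqLength {k : ℕ} (c : Fin k → F) : ℕ := (Finset.univ.filter fun j => c j ≠ 0).card

/-- `s(L)`: the minimal length of a nonzero equation induced by `L`. -/
noncomputable def sMin {m k : ℕ} (L : Matrix (Fin m) (Fin k) F) : ℕ :=
  sInf {s | ∃ c : Fin k → F, c ≠ 0 ∧ InducedEq L c ∧ eqLength c = s}

/-- `c(L)`: `s(L)` rounded up to the nearest even number. -/
noncomputable def cEven {m k : ℕ} (L : Matrix (Fin m) (Fin k) F) : ℕ :=
  if Even (sMin L) then sMin L else sMin L + 1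

/-- `B` is a critical set for `L`: `|B| = c(L)` and `L` induces some system on `B`. -/
def IsCriticalSet {m k : ℕ} (L : Matrix (Fin m) (Fin k) F) (B : Finset (Fin k)) : Prop :=
  B.card = cEven L ∧ ∃ (m' : ℕ) (L' : Matrix (Fin m') (Fin B.card) F),
    1 ≤ m' ∧ RowsIndep L' ∧ InducesOn L L' B rfl

/-- `m_B`: the maximal `m'` such that `L` induces an `(m' × |B|)`-system on `B`. -/
noncomputable def mMax {m k : ℕ} (L : Matrix (Fin m) (Fin k) F) (B : Finset (Fin k)) : ℕ :=
  sSup {m' | ∃ L' : Matrix (Fin m') (Fin B.card) F, RowsIndep L' ∧ InducesOn L L' B rfl}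

/-- `Φ_L(B, f)`. -/
noncomputable def Phi {m k n : ℕ} (L : Matrix (Fin m) (Fin k) F) (B : Finset (Fin k))
    (f : (Fin n → F) → ℝ) : ℝ :=
  (∑ x ∈ solutions L n, ∏ j ∈ B, f (x j)) / (solutions L n).card

/-- `B` is rank-reducing for `L`: deleting the columns indexed by `B` decreases the rank. -/
def RankReducing {m k : ℕ} (L : Matrix (Fin m) (Fin k) F) (B : Finset (Fin k)) : Prop :=
  (L.submatrix id fun j : {j : Fin k // j ∉ B} => (j : Fin k)).rank < L.rank

end Defs

section TwoByFour

variable {F : Type} [Field F] [DecidableEq F]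

/-- In a `(2 × 4)`-system with `s(L) = 3`, all `2 × 2` minors are nonzero. -/
lemma minor_ne_zero_of_sMin_eq_three {L : Matrix (Fin 2) (Fin 4) F} (hL : RowsIndep L)
    (hs : sMin L = 3) {i j : Fin 4} (hij : i ≠ j) :
    L 0 i * L 1 j - L 0 j * L 1 i ≠ 0 := by
  intro hdet
  obtain ⟨u, v, huv, hi, hj⟩ : ∃ u v : F, (u ≠ 0 ∨ v ≠ 0) ∧
      u * L 0 i + v * L 1 i = 0 ∧ u * L 0 j + v * L 1 j = 0 := by
    by_cases h0 : L 1 i = 0 ∧ L 0 i = 0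
    · by_cases h1 : L 1 j = 0 ∧ L 0 j = 0
      · exact ⟨1, 0, by simp, by simp [h0], by simp [h1]⟩
      · refine ⟨L 1 j, -L 0 j, ?_, by simp [h0], by ring⟩
        by_contra! h
        exact h1 ⟨h.1, by simpa using h.2⟩
    · refine ⟨L 1 i, -L 0 i, ?_, by ring, by linear_combination -hdet⟩
      by_contra! h
      exact h0 ⟨h.1, by simpa using h.2⟩
  have hne : (fun k => u * L 0 k + v * L 1 k) ≠ 0 := by
    intro h
    have := (LinearIndependent.pair_iff (R := F) (x := L 0) (y := L 1)).1
      (by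
        have e : (![L 0, L 1] : Fin 2 → Fin 4 → F) = fun i j => L i j := by
          funext r; fin_cases r <;> rfl
        rw [e]; exact hL) u v (by
          funext k
          simpa using congrFun h k)
    tauto
  have hle : sMin L ≤ eqLength (fun k => u * L 0 k + v * L 1 k) := by
    refine Nat.sInf_le ⟨_, hne, ?_, rfl⟩
    intro x hx
    have e0 := hx 0
    have e1 := hx 1
    calc ∑ k, (u * L 0 k + v * L 1 k) * x k
        = u * ∑ k, L 0 k * x k + v * ∑ k, L 1 k * x k := by
          rw [Finset.mul_sum, Finset.mul_sum, ← Finset.sum_add_distrib]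
          exact Finset.sum_congr rfl fun k _ => by ring
      _ = 0 := by rw [e0, e1]; ring
  have hlen : eqLength (fun k => u * L 0 k + v * L 1 k) ≤ 2 := by
    have hsub : (Finset.univ.filter fun k => u * L 0 k + v * L 1 k ≠ 0) ⊆
        (Finset.univ.erase i).erase j := by
      intro k hk
      simp only [Finset.mem_filter, Finset.mem_univ, true_and] at hk
      simp only [Finset.mem_erase, Finset.mem_univ, and_true]
      exact ⟨fun h => hk (h ▸ hj), fun h => hk (h ▸ hi)⟩
    refine (Finset.card_le_card hsub).trans ?_
    rw [Finset.card_erase_of_mem (by simp [hij.symm]), Finset.card_erase_of_mem (by simp)]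
    simp
  omega

/-- The scalar solutions of a system. -/
def scalarSolutions [Fintype F] {m k : ℕ} (L : Matrix (Fin m) (Fin k) F) : Finset (Fin k → F) :=
  Finset.univ.filter fun c => ∀ i, ∑ j, L i j * c j = 0

lemma exists_complementary_pair (i j : Fin 4) (hij : i ≠ j) :
    ∃ k l : Fin 4, k ≠ l ∧ i ≠ k ∧ i ≠ l ∧ j ≠ k ∧ j ≠ l ∧ Finset.univ = {i, j, k, l} := by
  revert i j
  decide

/-- If all `2 × 2` minors are nonzero, any two coordinates parametrise the scalar solutions. -/
lemma existsUnique_scalarSolution [Fintype F] {L : Matrix (Fin 2) (Fin 4) F}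
    (hL : ∀ i j : Fin 4, i ≠ j → L 0 i * L 1 j - L 0 j * L 1 i ≠ 0)
    {i j : Fin 4} (hij : i ≠ j) (s t : F) :
    ∃! c, c ∈ scalarSolutions L ∧ c i = s ∧ c j = t := by
  obtain ⟨k, l, hkl, hik, hil, hjk, hjl, huniv⟩ := exists_complementary_pair i j hij
  have hsum : ∀ f : Fin 4 → F, ∑ r, f r = f i + (f j + (f k + f l)) := by
    intro f
    rw [huniv, Finset.sum_insert (by simp [hij, hik, hil]),
      Finset.sum_insert (by simp [hjk, hjl]), Finset.sum_pair hkl]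
  have hD := hL k l hkl
  set D := L 0 k * L 1 l - L 0 l * L 1 k with hDdef
  refine ⟨fun r => if r = i then s else if r = j then t else
    if r = k then (-(L 0 i * s + L 0 j * t) * L 1 l + (L 1 i * s + L 1 j * t) * L 0 l) / D
    else (-(L 1 i * s + L 1 j * t) * L 0 k + (L 0 i * s + L 0 j * t) * L 1 k) / D, ?_, ?_⟩
  · refine ⟨?_, by simp, by simp [hij.symm]⟩
    simp only [scalarSolutions, Finset.mem_filter, Finset.mem_univ, true_and, hsum]
    simp only [if_true, hij.symm, hik.symm, hil.symm, hjk.symm, hjl.symm, hkl.symm, if_false]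
    rw [Fin.forall_fin_two]
    constructor <;> field_simp <;> rw [hDdef] <;> ring
  · rintro c ⟨hc, hci, hcj⟩
    simp only [scalarSolutions, Finset.mem_filter, Finset.mem_univ, true_and, hsum] at hc
    have e0 := hc 0
    have e1 := hc 1
    rw [hci, hcj] at e0 e1
    funext r
    have hr : r ∈ ({i, j, k, l} : Finset (Fin 4)) := huniv ▸ Finset.mem_univ r
    simp only [Finset.mem_insert, Finset.mem_singleton] at hr
    rcases hr with rfl | rfl | rfl | rfl
    · simp [hci]
    · simp [hij.symm, hcj]
    · simp only [hik.symm, hjk.symm, if_false, if_true]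
      rw [eq_div_iff hD, hDdef]
      linear_combination L 1 l * e0 - L 0 l * e1
    · simp only [hil.symm, hjl.symm, hkl.symm, if_false]
      rw [eq_div_iff hD, hDdef]
      linear_combination L 0 k * e1 - L 1 k * e0

lemma zero_mem_scalarSolutions [Fintype F] {m k : ℕ} (L : Matrix (Fin m) (Fin k) F) :
    0 ∈ scalarSolutions L := by
  simp [scalarSolutions]

lemma eq_zero_of_mem_scalarSolutions [Fintype F] {L : Matrix (Fin 2) (Fin 4) F}
    (hL : ∀ i j : Fin 4, i ≠ j → L 0 i * L 1 j - L 0 j * L 1 i ≠ 0)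
    {i j : Fin 4} (hij : i ≠ j) {c : Fin 4 → F} (hc : c ∈ scalarSolutions L)
    (hi : c i = 0) (hj : c j = 0) : c = 0 :=
  (existsUnique_scalarSolution hL hij 0 0).unique ⟨hc, hi, hj⟩
    ⟨zero_mem_scalarSolutions L, rfl, rfl⟩

lemma card_scalarSolutions [Fintype F] {L : Matrix (Fin 2) (Fin 4) F}
    (hL : ∀ i j : Fin 4, i ≠ j → L 0 i * L 1 j - L 0 j * L 1 i ≠ 0) :
    (scalarSolutions L).card = Fintype.card F ^ 2 := by
  have h : (scalarSolutions L).card = (Finset.univ : Finset (F × F)).card := by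
    refine Finset.card_bij (fun c _ => (c 0, c 1)) (fun _ _ => Finset.mem_univ _) ?_ ?_
    · intro c hc c' hc' h
      rw [Prod.mk.injEq] at h
      exact (existsUnique_scalarSolution hL (show (0 : Fin 4) ≠ 1 by decide) (c' 0) (c' 1)).unique
        ⟨hc, h⟩ ⟨hc', rfl, rfl⟩
    · rintro ⟨s, t⟩ -
      obtain ⟨c, ⟨hc, rfl, rfl⟩, -⟩ :=
        existsUnique_scalarSolution hL (show (0 : Fin 4) ≠ 1 by decide) s t
      exact ⟨c, hc, rfl⟩
  rw [h, Finset.card_univ, Fintype.card_prod, sq]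

lemma card_scalarSolutions_filter [Fintype F] {L : Matrix (Fin 2) (Fin 4) F}
    (hL : ∀ i j : Fin 4, i ≠ j → L 0 i * L 1 j - L 0 j * L 1 i ≠ 0) (j : Fin 4) :
    ((scalarSolutions L).filter fun c => c j = 0).card = Fintype.card F := by
  obtain ⟨i, hij⟩ := exists_ne j
  rw [← Finset.card_univ]
  refine Finset.card_bij (fun c _ => c i) (fun _ _ => Finset.mem_univ _) ?_ ?_
  · intro c hc c' hc' h
    rw [Finset.mem_filter] at hc hc'
    exact (existsUnique_scalarSolution hL hij (c' i) 0).unique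
      ⟨hc.1, h, hc.2⟩ ⟨hc'.1, rfl, hc'.2⟩
  · intro s _
    obtain ⟨c, ⟨hc, rfl, h0⟩, -⟩ := existsUnique_scalarSolution hL hij s 0
    exact ⟨c, Finset.mem_filter.2 ⟨hc, h0⟩, rfl⟩

/-- The sum over the nonzero scalar solutions for a function on `F` that is `-1` at the origin and
constant elsewhere. -/
lemma sum_scalarSolutions_erase_zero [Fintype F] {L : Matrix (Fin 2) (Fin 4) F}
    (hL : ∀ i j : Fin 4, i ≠ j → L 0 i * L 1 j - L 0 j * L 1 i ≠ 0) (a : ℝ) :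
    ∑ c ∈ (scalarSolutions L).erase 0, ∏ j, (if c j = 0 then (-1 : ℝ) else a) =
      ((Fintype.card F : ℝ) - 1) * ((Fintype.card F : ℝ) - 3) * a ^ 4 -
        4 * ((Fintype.card F : ℝ) - 1) * a ^ 3 := by
  have hpt : ∀ c ∈ scalarSolutions L, ∏ j, (if c j = 0 then (-1 : ℝ) else a) =
      a ^ 4 - (a ^ 3 + a ^ 4) * ∑ j, (if c j = 0 then (1 : ℝ) else 0) +
        (if c = 0 then 1 + 3 * a ^ 4 + 4 * a ^ 3 else 0) := by
    intro c hc
    by_cases h0 : c = 0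
    · subst h0
      simp
      ring
    · have hz : ∀ i j : Fin 4, i ≠ j → c i = 0 → c j ≠ 0 := fun i j hij hi hj =>
        h0 (eq_zero_of_mem_scalarSolutions hL hij hc hi hj)
      rw [if_neg h0, Fin.prod_univ_four, Fin.sum_univ_four]
      have h01 := hz 0 1 (by decide)
      have h02 := hz 0 2 (by decide)
      have h03 := hz 0 3 (by decide)
      have h12 := hz 1 2 (by decide)
      have h13 := hz 1 3 (by decide)
      have h23 := hz 2 3 (by decide)
      by_cases c0 : c 0 = 0
      · simp only [c0, h01 c0, h02 c0, h03 c0, if_true, if_false]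
        ring
      by_cases c1 : c 1 = 0
      · simp only [c0, c1, h12 c1, h13 c1, if_true, if_false]
        ring
      by_cases c2 : c 2 = 0
      · simp only [c0, c1, c2, h23 c2, if_true, if_false]
        ring
      by_cases c3 : c 3 = 0 <;> simp only [c0, c1, c2, c3, if_true, if_false] <;> ring
  have hfull : ∑ c ∈ scalarSolutions L, ∏ j, (if c j = 0 then (-1 : ℝ) else a) =
      (Fintype.card F : ℝ) ^ 2 * a ^ 4 - (a ^ 3 + a ^ 4) * (4 * (Fintype.card F : ℝ)) +
        (1 + 3 * a ^ 4 + 4 * a ^ 3) := by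
    rw [Finset.sum_congr rfl hpt, Finset.sum_add_distrib, Finset.sum_sub_distrib,
      ← Finset.mul_sum, Finset.sum_comm, Finset.sum_ite_eq' (scalarSolutions L) 0,
      if_pos (zero_mem_scalarSolutions L)]
    have hj : ∀ j : Fin 4, ∑ c ∈ scalarSolutions L, (if c j = 0 then (1 : ℝ) else 0) =
        Fintype.card F := by
      intro j
      rw [Finset.sum_boole, card_scalarSolutions_filter hL]
    simp only [hj, Finset.sum_const, card_scalarSolutions hL, Finset.card_univ, Fintype.card_fin,
      nsmul_eq_mul]
    push_cast
    ring
  rw [Finset.sum_erase_eq_sub (zero_mem_scalarSolutions L), hfull]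
  simp
  ring

/-- The function on `F^d` that is `-1` at the origin, `a i` at the nonzero points of the `i`-th
coordinate axis, and `0` elsewhere. -/
def axisFun {d : ℕ} (a : Fin d → ℝ) (x : Fin d → F) : ℝ :=
  if x = 0 then -1 else ∑ i, if ∀ r, r ≠ i → x r = 0 then a i else 0

lemma axisFun_single {d : ℕ} (a : Fin d → ℝ) (i : Fin d) (c : F) :
    axisFun a (Pi.single i c) = if c = 0 then -1 else a i := by
  by_cases hc : c = 0
  · simp [axisFun, hc]
  · have h : (Pi.single i c : Fin d → F) ≠ 0 := by simpa using hc
    rw [axisFun, if_neg h, if_neg hc, Finset.sum_eq_single i]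
    · rw [if_pos]
      intro r hr
      simp [hr]
    · intro b _ hb
      rw [if_neg]
      intro h'
      have := h' i hb.symm
      simp [hc] at this
    · simp

lemma exists_single_of_axisFun_ne_zero {d : ℕ} {a : Fin d → ℝ} {x : Fin d → F} (hx : x ≠ 0)
    (h : axisFun a x ≠ 0) : ∃ i c, c ≠ 0 ∧ x = Pi.single i c := by
  rw [axisFun, if_neg hx] at h
  obtain ⟨i, -, hi⟩ := Finset.exists_ne_zero_of_sum_ne_zero h
  have hi' : ∀ r, r ≠ i → x r = 0 := by
    by_contra hcon
    exact hi (if_neg hcon)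
  have hxi : x = Pi.single i (x i) := by
    funext r
    by_cases hr : r = i
    · subst hr; simp
    · simp [hr, hi' r hr]
  refine ⟨i, x i, ?_, hxi⟩
  intro h0
  rw [h0, Pi.single_zero] at hxi
  exact hx hxi

lemma abs_axisFun_le_one {d : ℕ} {a : Fin d → ℝ} (ha : ∀ i, |a i| ≤ 1) (x : Fin d → F) :
    |axisFun a x| ≤ 1 := by
  by_cases hx : x = 0
  · simp [axisFun, hx]
  by_cases h : axisFun a x = 0
  · simp [h]
  obtain ⟨i, c, hc, rfl⟩ := exists_single_of_axisFun_ne_zero hx h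
  rw [axisFun_single, if_neg hc]
  exact ha i

lemma sum_axisFun [Fintype F] {d : ℕ} (a : Fin d → ℝ) :
    ∑ x : Fin d → F, axisFun a x = -1 + ((Fintype.card F : ℝ) - 1) * ∑ i, a i := by
  rw [← Finset.add_sum_erase _ _ (Finset.mem_univ (0 : Fin d → F))]
  congr 1
  · simp [axisFun]
  · have h := Finset.sum_of_injOn (s := (Finset.univ : Finset (Fin d)) ×ˢ
        (Finset.univ.erase (0 : F))) (t := Finset.univ.erase (0 : Fin d → F))
      (f := fun p => a p.1) (g := axisFun a) (fun p => Pi.single p.1 p.2) ?_ ?_ ?_ ?_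
    · rw [← h, Finset.sum_product, Finset.mul_sum]
      refine Finset.sum_congr rfl fun i _ => ?_
      change ∑ _c ∈ Finset.univ.erase (0 : F), a i = _
      rw [Finset.sum_const, Finset.card_erase_of_mem (Finset.mem_univ _), Finset.card_univ,
        nsmul_eq_mul, Nat.cast_sub Fintype.card_pos]
      simp
    · rintro ⟨i, c⟩ h ⟨i', c'⟩ - heq
      have hc : c ≠ 0 := by simpa using h
      by_cases hii : i = i'
      · subst hii
        simpa using heq
      · have := congrFun heq i
        simp [hii, hc] at this
    · rintro ⟨i, c⟩ h
      simpa using h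
    · intro x hx hni
      by_contra hne
      obtain ⟨i, c, hc, rfl⟩ := exists_single_of_axisFun_ne_zero (Finset.ne_of_mem_erase hx) hne
      exact hni ⟨(i, c), by simpa using hc, rfl⟩
    · rintro ⟨i, c⟩ h
      have hc : c ≠ 0 := by simpa using h
      simp [axisFun_single, hc]

/-- A solution whose entries all lie on coordinate axes lies on a single axis. -/
lemma exists_single_of_mem_solutions [Fintype F] {L : Matrix (Fin 2) (Fin 4) F}
    (hL : ∀ i j : Fin 4, i ≠ j → L 0 i * L 1 j - L 0 j * L 1 i ≠ 0) {d : ℕ}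
    {x : Fin 4 → Fin d → F} (hx : x ∈ solutions L d) (h0 : x ≠ 0)
    (hax : ∀ j, x j ≠ 0 → ∃ i c, c ≠ 0 ∧ x j = Pi.single i c) :
    ∃ i, ∃ c ∈ (scalarSolutions L).erase 0, x = fun j => Pi.single i (c j) := by
  have hcoord : ∀ r, (fun j => x j r) ∈ scalarSolutions L := by
    intro r
    simp only [solutions, scalarSolutions, Finset.mem_filter, Finset.mem_univ, true_and] at hx ⊢
    intro i
    simpa using congrFun (hx i) r
  obtain ⟨j, hj⟩ := Function.ne_iff.1 h0
  obtain ⟨i, s, hs, hxj⟩ := hax j hj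
  have hxji : x j i ≠ 0 := by simp [hxj, hs]
  have key : ∀ k, x k = Pi.single i (x k i) := by
    intro k
    by_cases hk : x k = 0
    · simp [hk]
    obtain ⟨i', t, ht, hxk⟩ := hax k hk
    by_cases hii : i' = i
    · subst hii
      simp [hxk]
    exfalso
    have hxki : x k i = 0 := by simp [hxk, Ne.symm hii]
    have hxji' : x j i' = 0 := by simp [hxj, hii]
    have hjk : j ≠ k := by
      rintro rfl
      exact hxji hxki
    obtain ⟨l, -, -, hjl, -, hkl, -, -⟩ := exists_complementary_pair j k hjk
    have h1 : x l i ≠ 0 := fun h => hxji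
      (congrFun (eq_zero_of_mem_scalarSolutions hL hkl (hcoord i) hxki h) j)
    have h2 : x l i' ≠ 0 := fun h => by
      have := congrFun (eq_zero_of_mem_scalarSolutions hL hjl (hcoord i') hxji' h) k
      simp [hxk, ht] at this
    obtain ⟨e, w, hw, hxl⟩ := hax l (fun h => h1 (by simp [h]))
    rw [hxl] at h1 h2
    have he1 : i = e := by
      by_contra hne
      simp [hne] at h1
    have he2 : i' = e := by
      by_contra hne
      simp [hne] at h2
    exact hii (he2.trans he1.symm)
  refine ⟨i, fun k => x k i, ?_, funext key⟩
  rw [Finset.mem_erase]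
  exact ⟨fun h => hxji (congrFun h j), hcoord i⟩

lemma sum_solutions_axisFun [Fintype F] {L : Matrix (Fin 2) (Fin 4) F}
    (hL : ∀ i j : Fin 4, i ≠ j → L 0 i * L 1 j - L 0 j * L 1 i ≠ 0) {d : ℕ} (a : Fin d → ℝ) :
    ∑ x ∈ solutions L d, ∏ j, axisFun a (x j) =
      1 + ∑ i, (((Fintype.card F : ℝ) - 1) * ((Fintype.card F : ℝ) - 3) * a i ^ 4 -
        4 * ((Fintype.card F : ℝ) - 1) * a i ^ 3) := by
  have hmem : (0 : Fin 4 → Fin d → F) ∈ solutions L d := by simp [solutions]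
  rw [← Finset.add_sum_erase _ _ hmem]
  congr 1
  · norm_num [axisFun]
  · have h := Finset.sum_of_injOn (s := (Finset.univ : Finset (Fin d)) ×ˢ
        ((scalarSolutions L).erase 0)) (t := (solutions L d).erase 0)
      (f := fun p => ∏ j, (if p.2 j = 0 then (-1 : ℝ) else a p.1))
      (g := fun x => ∏ j, axisFun a (x j)) (fun p j => Pi.single p.1 (p.2 j)) ?_ ?_ ?_ ?_
    · rw [← h, Finset.sum_product]
      exact Finset.sum_congr rfl fun i _ => sum_scalarSolutions_erase_zero hL (a i)
    · rintro ⟨i, c⟩ h ⟨i', c'⟩ - heq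
      have hc : c ≠ 0 := by
        simp only [Finset.coe_product, Set.mem_prod, Finset.mem_coe, Finset.mem_erase] at h
        exact h.2.1
      have hii : i = i' := by
        by_contra hii
        obtain ⟨j, hj⟩ := Function.ne_iff.1 hc
        have := congrFun (congrFun heq j) i
        simp [hii] at this
        exact hj this
      subst hii
      rw [Prod.mk.injEq]
      refine ⟨rfl, funext fun j => ?_⟩
      simpa using congrFun heq j
    · rintro ⟨i, c⟩ h
      simp only [Finset.coe_product, Set.mem_prod, Finset.mem_coe, Finset.mem_erase] at h ⊢
      obtain ⟨-, hc, hcs⟩ := h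
      constructor
      · intro h0
        apply hc
        funext j
        simpa using congrFun h0 j
      · simp only [solutions, scalarSolutions, Finset.mem_filter, Finset.mem_univ,
          true_and] at hcs ⊢
        intro r
        funext e
        by_cases hei : e = i
        · subst hei
          simpa using hcs r
        · simp [hei]
    · intro x hx hni
      by_contra hne
      rw [Finset.mem_erase] at hx
      obtain ⟨i, c, hc, rfl⟩ := exists_single_of_mem_solutions hL hx.2 hx.1
        (fun j hj => exists_single_of_axisFun_ne_zero hj (Finset.prod_ne_zero_iff.1 hne j
          (Finset.mem_univ j)))
      exact hni ⟨(i, c), by simpa [and_comm] using hc, rfl⟩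
    · rintro ⟨i, c⟩ -
      simp [axisFun_single]

/-- Weights on the coordinate axes making `axisFun` balanced with a negative solution count. -/
lemma exists_axis_weights {q : ℕ} (hq : 2 ≤ q) :
    ∃ d : ℕ, 1 ≤ d ∧ ∃ a : Fin d → ℝ, (∀ i, |a i| ≤ 1) ∧
      ((q : ℝ) - 1) * ∑ i, a i = 1 ∧
      1 + ∑ i, (((q : ℝ) - 1) * ((q : ℝ) - 3) * a i ^ 4 -
        4 * ((q : ℝ) - 1) * a i ^ 3) ≤ -(1 / 2) := by
  obtain ⟨p, rfl⟩ : ∃ p, q = p + 1 := ⟨q - 1, by omega⟩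
  have hp : 1 ≤ p := by omega
  have hp' : (1 : ℝ) ≤ p := by exact_mod_cast hp
  have hp0 : (0 : ℝ) < p := by linarith
  obtain ⟨k, hk⟩ : ∃ k : ℕ, (k : ℝ) = 2 * ((p : ℝ) ^ 2 - 1) :=
    ⟨2 * (p ^ 2 - 1), by
      rw [Nat.cast_mul, Nat.cast_sub (Nat.one_le_pow _ _ hp)]
      push_cast
      ring⟩
  refine ⟨p ^ 2 + k, ?_, Fin.append (fun _ => 1 / (p : ℝ)) (fun _ => -(1 / (2 * (p : ℝ)))),
    ?_, ?_, ?_⟩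
  · have := Nat.one_le_pow 2 p hp
    omega
  · intro i
    refine Fin.addCases (fun i => ?_) (fun i => ?_) i
    · rw [Fin.append_left, abs_of_pos (by positivity)]
      exact (div_le_one hp0).2 hp'
    · rw [Fin.append_right, abs_neg, abs_of_pos (by positivity)]
      exact (div_le_one (by positivity)).2 (by linarith)
  · rw [Fin.sum_univ_add]
    simp only [Fin.append_left, Fin.append_right, Finset.sum_const, Finset.card_univ,
      Fintype.card_fin, nsmul_eq_mul, hk]
    push_cast
    field_simp
    ring
  · rw [Fin.sum_univ_add]
    simp only [Fin.append_left, Fin.append_right, Finset.sum_const, Finset.card_univ,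
      Fintype.card_fin, nsmul_eq_mul, hk]
    push_cast
    have e : (1 : ℝ) + ((p : ℝ) ^ 2 * (((p : ℝ) + 1 - 1) * ((p : ℝ) + 1 - 3) * (1 / (p : ℝ)) ^ 4 -
        4 * ((p : ℝ) + 1 - 1) * (1 / (p : ℝ)) ^ 3) + 2 * ((p : ℝ) ^ 2 - 1) *
        (((p : ℝ) + 1 - 1) * ((p : ℝ) + 1 - 3) * (-(1 / (2 * (p : ℝ)))) ^ 4 -
        4 * ((p : ℝ) + 1 - 1) * (-(1 / (2 * (p : ℝ)))) ^ 3)) =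
        -(1 / 2) - (3 * (p : ℝ) ^ 3 + 18 * (p : ℝ) ^ 2 + 9 * (p : ℝ) - 2) / (8 * (p : ℝ) ^ 3) := by
      field_simp
      ring
    rw [e]
    have : 0 ≤ (3 * (p : ℝ) ^ 3 + 18 * (p : ℝ) ^ 2 + 9 * (p : ℝ) - 2) / (8 * (p : ℝ) ^ 3) := by
      apply div_nonneg _ (by positivity)
      nlinarith [pow_pos hp0 2, pow_pos hp0 3]
    linarith

end TwoByFour

/-- there exist `ν > 0`, `d ≥ 1` and a balanced `ψ : F_q^d → [−1/4, 1/4]`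
with `Λ_L(ψ) < −ν` for every `(2 × 4)`-system `L` over `F_q` with `s(L) = 3`. -/
theorem exists_negative_function_for_two_by_four
    {F : Type} [Field F] [Fintype F] [DecidableEq F] :
    ∃ (ν : ℝ), 0 < ν ∧ ∃ (d : ℕ), 1 ≤ d ∧ ∃ ψ : (Fin d → F) → ℝ,
      (∑ y : Fin d → F, ψ y = 0) ∧
      (∀ y, ψ y ∈ Set.Icc (-(1 / 4) : ℝ) (1 / 4)) ∧
      ∀ L : Matrix (Fin 2) (Fin 4) F, RowsIndep L → sMin L = 3 →
        lambdaSol L ψ < -ν := by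
  obtain ⟨d, hd, a, ha, hbal, hneg⟩ :=
    exists_axis_weights (q := Fintype.card F) Fintype.one_lt_card
  have hT : (0 : ℝ) < Fintype.card (Fin 4 → Fin d → F) := by exact_mod_cast Fintype.card_pos
  refine ⟨1 / 1024 / Fintype.card (Fin 4 → Fin d → F), by positivity, d, hd,
    fun y => 1 / 4 * axisFun a y, ?_, ?_, ?_⟩
  · rw [← Finset.mul_sum, sum_axisFun, hbal]
    norm_num
  · intro y
    have := abs_le.1 (abs_axisFun_le_one ha y)
    constructor <;> linarith
  · intro L hL hs
    have hminor := fun i j (hij : i ≠ j) => minor_ne_zero_of_sMin_eq_three hL hs hij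
    have hcard : (0 : ℝ) < (solutions L d).card := by
      have : (0 : Fin 4 → Fin d → F) ∈ solutions L d := by simp [solutions]
      exact_mod_cast Finset.card_pos.2 ⟨_, this⟩
    have hle : ((solutions L d).card : ℝ) ≤ Fintype.card (Fin 4 → Fin d → F) := by
      exact_mod_cast Finset.card_le_univ _
    have hsum : ∑ x ∈ solutions L d, ∏ j, (1 / 4 * axisFun a (x j)) ≤ -(1 / 512) := by
      simp only [Finset.prod_mul_distrib, Finset.prod_const, Finset.card_univ, Fintype.card_fin]
      rw [← Finset.mul_sum, sum_solutions_axisFun hminor]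
      linarith
    rw [lambdaSol, div_lt_iff₀ hcard]
    have : 1 / 1024 / (Fintype.card (Fin 4 → Fin d → F) : ℝ) * (solutions L d).card ≤
        1 / 1024 := by
      rw [div_mul_eq_mul_div, div_le_iff₀ hT]
      linarith
    linarith
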